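/- Let Σ be a binding signature, M : NomTrm a nameful term and x, y : 𝔸 atoms. If y is fresh for M (y # M), then ⟦(x := y) * M⟧ = (x := 𝐚 y) * ⟦M⟧, i.e. the translation commutes with the single renaming of x to y. -/

import Mathlib

/- A Plotkin-style binding signature: operators with arities. -/
structure Sig where
  Op : Type
  ar : Op → List ℕ

/- Well-scoped locally nameless terms and argument lists over a signature.
Atoms are natural numbers. -/
mutual
inductive Trm (S : Sig) : ℕ → Type where
  | idx : {n : ℕ} → Fin n → Trm S n
  | atm : {n : ℕ} → ℕ → Trm S n
  | op  : {n : ℕ} → (o : S.Op) → Args S n (S.ar o) → Trm S n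
inductive Args (S : Sig) : ℕ → List ℕ → Type where
  | nil : {n : ℕ} → Args S n []
  | cons : {n m : ℕ} → {ms : List ℕ} → Trm S (m + n) → Args S n ms → Args S n (m :: ms)
end

variable {S : Sig}

/- Scope weakening. -/
mutual
def Trm.weaken : {m n : ℕ} → m ≤ n → Trm S m → Trm S n
  | _, _, h, .idx i => .idx (Fin.castLE h i)
  | _, _, _, .atm x => .atm x
  | _, _, h, .op o as => .op o (Args.weaken h as)
def Args.weaken : {m n : ℕ} → {ms : List ℕ} → m ≤ n → Args S m ms → Args S n ms
  | _, _, _, _, .nil => .nil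
  | _, _, _, h, .cons t ts => .cons (Trm.weaken (Nat.add_le_add_left h _) t) (Args.weaken h ts)
end

/- Support: the finite set of atoms occurring in a term. -/
mutual
def Trm.supp : {n : ℕ} → Trm S n → Finset ℕ
  | _, .idx _ => ∅
  | _, .atm x => {x}
  | _, .op _ as => Args.supp as
def Args.supp : {n : ℕ} → {ms : List ℕ} → Args S n ms → Finset ℕ
  | _, _, .nil => ∅
  | _, _, .cons t ts => Trm.supp t ∪ Args.supp ts
end

/- Action of a substitution σ : 𝔸 → Trm on terms. -/
mutual
def Trm.subst (σ : ℕ → Trm S 0) : {n : ℕ} → Trm S n → Trm S n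
  | _, .idx i => .idx i
  | n, .atm x => Trm.weaken (Nat.zero_le n) (σ x)
  | _, .op o as => .op o (Args.subst σ as)
def Args.subst (σ : ℕ → Trm S 0) : {n : ℕ} → {ms : List ℕ} → Args S n ms → Args S n ms
  | _, _, .nil => .nil
  | _, _, .cons t ts => .cons (Trm.subst σ t) (Args.subst σ ts)
end

/- The single substitution (x := u). -/
def single (x : ℕ) (u : Trm S 0) : ℕ → Trm S 0 := fun y => if x = y then u else .atm y

/- Renaming a term along ρ : 𝔸 → 𝔸, i.e. substitution along 𝐚 ∘ ρ. -/
def Trm.rename (ρ : ℕ → ℕ) {n : ℕ} (t : Trm S n) : Trm S n :=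
  Trm.subst (fun z => .atm (ρ z)) t

/- Opening (i ↝ u)t : replace index i by the 0-term u. -/
mutual
def Trm.opn : {n : ℕ} → Fin (n+1) → Trm S 0 → Trm S (n+1) → Trm S n
  | n, i, u, .idx j =>
      match finSuccEquiv' i j with
      | none => Trm.weaken (Nat.zero_le n) u
      | some k => .idx k
  | _, _, _, .atm x => .atm x
  | _, i, u, .op o as => .op o (Args.opn i u as)
def Args.opn : {n : ℕ} → {ms : List ℕ} → Fin (n+1) → Trm S 0 → Args S (n+1) ms → Args S n ms
  | _, _, _, _, .nil => .nil
  | _, _, i, u, .cons (m := k) t ts => .cons (Trm.opn (Fin.natAdd k i) u t) (Args.opn i u ts)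
end

/- Concretion t[u] of a (1+n)-term at a 0-term. -/
def Trm.conc {n : ℕ} (t : Trm S (n+1)) (u : Trm S 0) : Trm S n := Trm.opn 0 u t

/- Closing (i ↜ x)t : replace the atom x by the index i. -/
mutual
def Trm.cls : {n : ℕ} → Fin (n+1) → ℕ → Trm S n → Trm S (n+1)
  | _, i, _, .idx j => .idx (i.succAbove j)
  | _, i, x, .atm y => if x = y then .idx i else .atm y
  | _, i, x, .op o as => .op o (Args.cls i x as)
def Args.cls : {n : ℕ} → {ms : List ℕ} → Fin (n+1) → ℕ → Args S n ms → Args S (n+1) ms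
  | _, _, _, _, .nil => .nil
  | _, _, i, x, .cons (m := k) t ts => .cons (Trm.cls (Fin.natAdd k i) x t) (Args.cls i x ts)
end

/- Abstraction ⟨x⟩t. -/
def Trm.abs (x : ℕ) {n : ℕ} (t : Trm S n) : Trm S (n+1) := Trm.cls 0 x t

/- Size of a term. -/
mutual
def Trm.size : {n : ℕ} → Trm S n → ℕ
  | _, .idx _ => 0
  | _, .atm _ => 0
  | _, .op _ as => 1 + Args.size as
def Args.size : {n : ℕ} → {ms : List ℕ} → Args S n ms → ℕ
  | _, _, .nil => 0
  | _, _, .cons t ts => max (Trm.size t) (Args.size ts)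
end

/- Nameful terms, argument lists and n-ary bindings over a signature. -/
mutual
inductive NomTrm (S : Sig) : Type where
  | atm : ℕ → NomTrm S
  | op : (o : S.Op) → NomArg S (S.ar o) → NomTrm S
inductive NomArg (S : Sig) : List ℕ → Type where
  | nil : NomArg S []
  | cons : {m : ℕ} → {ms : List ℕ} → NomBind S m → NomArg S ms → NomArg S (m :: ms)
inductive NomBind (S : Sig) : ℕ → Type where
  | body : NomTrm S → NomBind S 0
  | bind : {m : ℕ} → ℕ → NomBind S m → NomBind S (m+1)
end

/- Support of a nameful term: all atoms occurring, in atom or binding position. -/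
mutual
def NomTrm.nsupp : NomTrm S → Finset ℕ
  | .atm x => {x}
  | .op _ bs => NomArg.nsupp bs
def NomArg.nsupp : {ms : List ℕ} → NomArg S ms → Finset ℕ
  | _, .nil => ∅
  | _, .cons b bs => NomBind.nsupp b ∪ NomArg.nsupp bs
def NomBind.nsupp : {m : ℕ} → NomBind S m → Finset ℕ
  | _, .body M => NomTrm.nsupp M
  | _, .bind x b => insert x (NomBind.nsupp b)
end

/- Renaming of nameful terms: apply ρ to every atom occurrence, including
binding positions. -/
mutual
def NomTrm.rename (ρ : ℕ → ℕ) : NomTrm S → NomTrm S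
  | .atm x => .atm (ρ x)
  | .op o bs => .op o (NomArg.rename ρ bs)
def NomArg.rename (ρ : ℕ → ℕ) : {ms : List ℕ} → NomArg S ms → NomArg S ms
  | _, .nil => .nil
  | _, .cons b bs => .cons (NomBind.rename ρ b) (NomArg.rename ρ bs)
def NomBind.rename (ρ : ℕ → ℕ) : {m : ℕ} → NomBind S m → NomBind S m
  | _, .body M => .body (NomTrm.rename ρ M)
  | _, .bind x b => .bind (ρ x) (NomBind.rename ρ b)
end

/- The single renaming function sending x to y and fixing all other atoms. -/
def rn1 (x y : ℕ) : ℕ → ℕ := fun z => if x = z then y else z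

/- α-equivalence of nameful terms. -/
mutual
inductive AEq {S : Sig} : NomTrm S → NomTrm S → Prop where
  | atm (x : ℕ) : AEq (.atm x) (.atm x)
  | op {o : S.Op} {bs bs' : NomArg S (S.ar o)} :
      AEqArg bs bs' → AEq (.op o bs) (.op o bs')
inductive AEqArg {S : Sig} : {ms : List ℕ} → NomArg S ms → NomArg S ms → Prop where
  | nil : AEqArg .nil .nil
  | cons {m : ℕ} {ms : List ℕ} {b b' : NomBind S m} {bs bs' : NomArg S ms} :
      AEqBind b b' → AEqArg bs bs' → AEqArg (.cons b bs) (.cons b' bs')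
inductive AEqBind {S : Sig} : {m : ℕ} → NomBind S m → NomBind S m → Prop where
  | body {M M' : NomTrm S} : AEq M M' → AEqBind (.body M) (.body M')
  | bind {m : ℕ} {x x' y : ℕ} {b b' : NomBind S m} :
      y ∉ NomBind.nsupp b → y ∉ NomBind.nsupp b' →
      AEqBind (NomBind.rename (rn1 x y) b) (NomBind.rename (rn1 x' y) b') →
      AEqBind (.bind x b) (.bind x' b')
end

/- Translation of nameful terms into well-scoped locally nameless terms;
bindings translate to iterated abstractions. -/
mutual
def NomTrm.transl : NomTrm S → Trm S 0
  | .atm x => .atm x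
  | .op o bs => .op o (NomArg.transl bs)
def NomArg.transl : {ms : List ℕ} → NomArg S ms → Args S 0 ms
  | _, .nil => .nil
  | _, .cons b bs => .cons (NomBind.transl b) (NomArg.transl bs)
def NomBind.transl : {m : ℕ} → NomBind S m → Trm S m
  | _, .body M => NomTrm.transl M
  | _, .bind x b => Trm.cls 0 x (NomBind.transl b)
end

/- A chosen atom not in a given finite set (one more than its maximum). -/
def newAtom (s : Finset ℕ) : ℕ := s.sup id + 1

/- Capture-avoiding substitution of nameful terms for atoms. -/
mutual
def NomTrm.nsubst (σ : ℕ → NomTrm S) : NomTrm S → NomTrm S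
  | .atm x => σ x
  | .op o bs => .op o (NomArg.nsubst σ bs)
def NomArg.nsubst (σ : ℕ → NomTrm S) : {ms : List ℕ} → NomArg S ms → NomArg S ms
  | _, .nil => .nil
  | _, .cons b bs => .cons (NomBind.nsubst σ b) (NomArg.nsubst σ bs)
def NomBind.nsubst (σ : ℕ → NomTrm S) : {m : ℕ} → NomBind S m → NomBind S m
  | _, .body M => .body (NomTrm.nsubst σ M)
  | _, .bind x b =>
      let y := newAtom ((NomBind.nsupp b).biUnion (fun z => NomTrm.nsupp (σ z)))
      .bind y (NomBind.nsubst (fun z => if x = z then .atm y else σ z) b)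
end

mutual
theorem Trm.supp_cls_subset : {n : ℕ} → (i : Fin (n + 1)) → (x : ℕ) → (t : Trm S n) →
    (Trm.cls i x t).supp ⊆ t.supp
  | _, _, _, .idx _ => by simp [Trm.cls, Trm.supp]
  | _, _, x, .atm y => by
      by_cases h : x = y <;> simp [Trm.cls, Trm.supp, h]
  | _, i, x, .op _ as => by
      simpa only [Trm.cls, Trm.supp] using Args.supp_cls_subset i x as
theorem Args.supp_cls_subset : {n : ℕ} → {ms : List ℕ} → (i : Fin (n + 1)) → (x : ℕ) →
    (as : Args S n ms) → (Args.cls i x as).supp ⊆ as.supp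
  | _, _, _, _, .nil => by simp [Args.cls, Args.supp]
  | n, _, i, x, .cons (m := k) t ts => by
      simp only [Args.cls, Args.supp]
      exact Finset.union_subset_union (Trm.supp_cls_subset (n := k + n) (Fin.natAdd k i) x t)
        (Args.supp_cls_subset i x ts)
end

mutual
theorem NomTrm.supp_transl_subset : (M : NomTrm S) → M.transl.supp ⊆ M.nsupp
  | .atm _ => by simp [NomTrm.transl, Trm.supp, NomTrm.nsupp]
  | .op _ bs => by
      simpa only [NomTrm.transl, Trm.supp, NomTrm.nsupp] using NomArg.supp_transl_subset bs
theorem NomArg.supp_transl_subset : {ms : List ℕ} → (bs : NomArg S ms) →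
    bs.transl.supp ⊆ bs.nsupp
  | _, .nil => by simp [NomArg.transl, Args.supp]
  | _, .cons b bs => by
      simp only [NomArg.transl, Args.supp, NomArg.nsupp]
      exact Finset.union_subset_union (NomBind.supp_transl_subset b)
        (NomArg.supp_transl_subset bs)
theorem NomBind.supp_transl_subset : {m : ℕ} → (b : NomBind S m) → b.transl.supp ⊆ b.nsupp
  | _, .body M => by
      simpa only [NomBind.transl, NomBind.nsupp] using NomTrm.supp_transl_subset M
  | _, .bind x b => by
      simp only [NomBind.transl, NomBind.nsupp]
      exact ((Trm.supp_cls_subset 0 x _).trans (NomBind.supp_transl_subset b)).trans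
        (Finset.subset_insert _ _)
end

/- Closing commutes with the renaming of `x` to a fresh atom `y`; the closed atom `z` is
renamed as well, so `z = x` is allowed. -/
mutual
theorem Trm.cls_subst_single {x y z : ℕ} (hz : y ≠ z) : {n : ℕ} → (i : Fin (n + 1)) →
    (t : Trm S n) → y ∉ t.supp →
    Trm.cls i (rn1 x y z) (Trm.subst (single x (.atm y)) t) =
      Trm.subst (single x (.atm y)) (Trm.cls i z t)
  | _, _, .idx _, _ => by simp [Trm.cls, Trm.subst]
  | _, _, .atm w, hy => by
      have hw : y ≠ w := by simpa [Trm.supp] using hy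
      by_cases hxw : x = w <;> by_cases hxz : x = z <;> by_cases hzw : z = w <;>
        simp_all [Trm.cls, Trm.subst, Trm.weaken, single, rn1, eq_comm]
  | _, i, .op _ as, hy => by
      simp only [Trm.supp] at hy
      simp only [Trm.cls, Trm.subst, Args.cls_subst_single hz i as hy]
theorem Args.cls_subst_single {x y z : ℕ} (hz : y ≠ z) : {n : ℕ} → {ms : List ℕ} →
    (i : Fin (n + 1)) → (as : Args S n ms) → y ∉ as.supp →
    Args.cls i (rn1 x y z) (Args.subst (single x (.atm y)) as) =
      Args.subst (single x (.atm y)) (Args.cls i z as)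
  | _, _, _, .nil, _ => by simp [Args.cls, Args.subst]
  | n, _, i, .cons (m := k) t ts, hy => by
      simp only [Args.supp, Finset.notMem_union] at hy
      simp only [Args.cls, Args.subst, Args.cls_subst_single hz i ts hy.2]
      exact congrArg (Args.cons · _)
        (Trm.cls_subst_single (n := k + n) hz (Fin.natAdd k i) t hy.1)
end

mutual
theorem NomTrm.transl_rename_rn1 {x y : ℕ} : (M : NomTrm S) → y ∉ M.nsupp →
    (NomTrm.rename (rn1 x y) M).transl = Trm.subst (single x (.atm y)) M.transl
  | .atm z, _ => by
      by_cases h : x = z <;>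
        simp [NomTrm.rename, NomTrm.transl, Trm.subst, Trm.weaken, single, rn1, h]
  | .op _ bs, hy => by
      simp only [NomTrm.nsupp] at hy
      simp only [NomTrm.rename, NomTrm.transl, Trm.subst, NomArg.transl_rename_rn1 bs hy]
theorem NomArg.transl_rename_rn1 {x y : ℕ} : {ms : List ℕ} → (bs : NomArg S ms) →
    y ∉ bs.nsupp →
    (NomArg.rename (rn1 x y) bs).transl = Args.subst (single x (.atm y)) bs.transl
  | _, .nil, _ => by simp [NomArg.rename, NomArg.transl, Args.subst]
  | _, .cons b bs, hy => by
      simp only [NomArg.nsupp, Finset.notMem_union] at hy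
      simp only [NomArg.rename, NomArg.transl, Args.subst, NomArg.transl_rename_rn1 bs hy.2]
      exact congrArg (Args.cons · _) (NomBind.transl_rename_rn1 b hy.1)
theorem NomBind.transl_rename_rn1 {x y : ℕ} : {m : ℕ} → (b : NomBind S m) → y ∉ b.nsupp →
    (NomBind.rename (rn1 x y) b).transl = Trm.subst (single x (.atm y)) b.transl
  | _, .body M, hy => by
      simp only [NomBind.nsupp] at hy
      simp only [NomBind.rename, NomBind.transl, NomTrm.transl_rename_rn1 M hy]
  | _, .bind z b, hy => by
      simp only [NomBind.nsupp, Finset.mem_insert, not_or] at hy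
      simp only [NomBind.rename, NomBind.transl, NomBind.transl_rename_rn1 b hy.2]
      exact Trm.cls_subst_single hy.1 0 _ fun h => hy.2 (NomBind.supp_transl_subset b h)
end

/-- If y is fresh for M then ⟦(x := y) * M⟧ = (x := 𝐚 y) * ⟦M⟧. -/
theorem transl_rn1 (S : Sig) (M : NomTrm S) (x y : ℕ) (hy : y ∉ M.nsupp) :
    (NomTrm.rename (rn1 x y) M).transl = Trm.subst (single x (.atm y)) M.transl :=
  NomTrm.transl_rename_rn1 M hy
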